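/- arXiv:1809.08943 — 2 statements merged into one kernel-verified Lean document; each statement's English description precedes it below -/
import Mathlib

section
/- Let K be a convex body in the plane ℝ² (a compact convex set with nonempty interior). Then vol(K) ≥ (3/2)·λ₁((cs K)*)·λ₂((cs K)*) + (1/2)·λ₁((cs K)*)·(λ₂((cs K)*) − λ₁((cs K)*)), equivalently vol(K) ≥ 2·λ₁((cs K)*)·λ₂((cs K)*) − (1/2)·λ₁((cs K)*)², where λᵢ denote the successive minima with respect to the lattice ℤ². -/
open MeasureTheory
open scoped RealInnerProductSpace Pointwise

noncomputable section

/-- Euclidean `n`-space. -/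
abbrev E (n : ℕ) := EuclideanSpace ℝ (Fin n)

/-- A convex body: a compact convex set with nonempty interior. -/
def IsConvexBody {n : ℕ} (K : Set (E n)) : Prop :=
  Convex ℝ K ∧ IsCompact K ∧ (interior K).Nonempty

/-- Central symmetral `cs K = (1/2)(K - K)`. -/
def csBody {n : ℕ} (K : Set (E n)) : Set (E n) := (2⁻¹ : ℝ) • (K - K)

/-- Polar body `L* = {y : ⟨x, y⟩ ≤ 1 for all x ∈ L}`. -/
def polarBody {n : ℕ} (L : Set (E n)) : Set (E n) :=
  {y | ∀ x ∈ L, ⟪x, y⟫ ≤ 1}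

/-- A point of the integer lattice `ℤⁿ ⊆ ℝⁿ`. -/
def isLatticePoint {n : ℕ} (z : E n) : Prop := ∀ j, ∃ m : ℤ, z j = (m : ℝ)

/-- The `i`-th successive minimum of `L` with respect to the lattice `ℤⁿ`:
the least `λ > 0` such that `λ • L` contains `i` linearly independent lattice points. -/
def succMin {n : ℕ} (L : Set (E n)) (i : ℕ) : ℝ :=
  sInf {lam : ℝ | 0 < lam ∧ ∃ v : Fin i → E n,
    LinearIndependent ℝ v ∧ ∀ j, isLatticePoint (v j) ∧ v j ∈ lam • L}

/-- Twice the signed area of the triangle `X Y Z`. -/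
def cross (X Y Z : Fin 2 → ℝ) : ℝ :=
  (Y 0 - X 0) * (Z 1 - X 1) - (Y 1 - X 1) * (Z 0 - X 0)

theorem half_le_volume_stdTriangle :
    (1 / 2 : ENNReal) ≤ volume {x : Fin 2 → ℝ | 0 ≤ x 0 ∧ 0 ≤ x 1 ∧ x 0 + x 1 ≤ 1} := by
  set T : Set (Fin 2 → ℝ) := {x : Fin 2 → ℝ | 0 ≤ x 0 ∧ 0 ≤ x 1 ∧ x 0 + x 1 ≤ 1} with hT
  have hTm : MeasurableSet T := by
    have h0 : Measurable fun x : Fin 2 → ℝ => x 0 := measurable_pi_apply 0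
    have h1 : Measurable fun x : Fin 2 → ℝ => x 1 := measurable_pi_apply 1
    exact (measurableSet_le measurable_const h0).inter
      ((measurableSet_le measurable_const h1).inter
        (measurableSet_le (h0.add h1) measurable_const))
  have hcover : Set.Icc (0 : Fin 2 → ℝ) 1 ⊆ T ∪ (fun x => 1 - x) ⁻¹' T := by
    rintro x ⟨h0, h1⟩
    have a0 := h0 0
    have a1 := h0 1
    have b0 := h1 0
    have b1 := h1 1
    simp only [Pi.zero_apply, Pi.one_apply] at a0 a1 b0 b1
    by_cases h : x 0 + x 1 ≤ 1
    · exact Or.inl ⟨a0, a1, h⟩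
    · refine Or.inr ⟨?_, ?_, ?_⟩ <;> simp only [Pi.sub_apply, Pi.one_apply] <;> linarith
  have hpre : volume ((fun x : Fin 2 → ℝ => 1 - x) ⁻¹' T) = volume T :=
    (Measure.measurePreserving_sub_left volume (1 : Fin 2 → ℝ)).measure_preimage
      hTm.nullMeasurableSet
  have hsq : volume (Set.Icc (0 : Fin 2 → ℝ) 1) = 1 := by
    rw [Real.volume_Icc_pi]; simp
  have := (measure_mono hcover).trans (measure_union_le (μ := volume) _ _)
  rw [hsq, hpre, ← two_mul] at this
  rw [ENNReal.div_le_iff_le_mul (by simp) (by simp), mul_comm]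
  exact this

theorem Convex.abs_cross_div_two_le_volume {C : Set (Fin 2 → ℝ)} (hC : Convex ℝ C)
    (hfin : volume C ≠ ⊤) {X Y Z : Fin 2 → ℝ} (hX : X ∈ C) (hY : Y ∈ C) (hZ : Z ∈ C) :
    |cross X Y Z| / 2 ≤ volume.real C := by
  set M : Matrix (Fin 2) (Fin 2) ℝ := !![Y 0 - X 0, Z 0 - X 0; Y 1 - X 1, Z 1 - X 1] with hM
  have hsub : Matrix.toLin' M '' {x : Fin 2 → ℝ | 0 ≤ x 0 ∧ 0 ≤ x 1 ∧ x 0 + x 1 ≤ 1} ⊆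
      (fun w => X + w) ⁻¹' C := by
    rintro _ ⟨x, ⟨h0, h1, h2⟩, rfl⟩
    have := hC.sum_mem (t := Finset.univ) (w := ![1 - x 0 - x 1, x 0, x 1]) (z := ![X, Y, Z])
      (by intro i _; fin_cases i <;> simp <;> linarith)
      (by simp only [Fin.sum_univ_three, Matrix.cons_val]; ring)
      (by intro i _; fin_cases i <;> simp [hX, hY, hZ])
    simp only [Set.mem_preimage]
    convert this using 1
    ext i
    fin_cases i <;> simp [Fin.sum_univ_three, hM, dotProduct] <;> ring
  have h := measure_mono (μ := volume) hsub
  rw [measure_preimage_add, Measure.addHaar_image_linearMap, LinearMap.det_toLin'] at h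
  have hdet : M.det = cross X Y Z := by
    rw [hM, Matrix.det_fin_two_of, cross]; ring
  rw [hdet] at h
  have h' := (mul_le_mul_right half_le_volume_stdTriangle (ENNReal.ofReal |cross X Y Z|)).trans h
  have := ENNReal.toReal_mono hfin h'
  rw [ENNReal.toReal_mul, ENNReal.toReal_ofReal (abs_nonneg _)] at this
  simpa [Measure.real, div_eq_mul_inv] using this

theorem convex_cross_nonneg (X Y : Fin 2 → ℝ) : Convex ℝ {W | 0 ≤ cross X Y W} := by
  intro a ha b hb s t hs ht hst
  simp only [Set.mem_ofPred_eq, cross, Pi.add_apply, Pi.smul_apply, smul_eq_mul] at *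
  obtain rfl : s = 1 - t := by linarith
  nlinarith [mul_nonneg hs ha, mul_nonneg ht hb]

theorem continuous_cross (X Y : Fin 2 → ℝ) : Continuous (cross X Y) := by
  unfold cross; fun_prop

theorem cross_swap (X Y Z : Fin 2 → ℝ) : cross X Z Y = - cross X Y Z := by
  unfold cross; ring

theorem cross_rotate (X Y Z : Fin 2 → ℝ) : cross Y Z X = cross X Y Z := by
  unfold cross; ring

theorem volume_cross_eq_zero {X Y Z : Fin 2 → ℝ} (h : cross X Y Z ≠ 0) :
    volume {W | cross X Y W = 0} = 0 := by
  let f : (Fin 2 → ℝ) →ₗ[ℝ] ℝ :=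
    (Y 0 - X 0) • LinearMap.proj 1 - (Y 1 - X 1) • LinearMap.proj 0
  have hf : ∀ W, f (W - X) = cross X Y W := by
    intro W; simp [f, cross]
  have hker : LinearMap.ker f ≠ ⊤ := by
    intro htop
    apply h
    rw [← hf, ← LinearMap.mem_ker, htop]
    trivial
  have := Measure.addHaar_submodule volume (LinearMap.ker f) hker
  rw [← measure_preimage_add_right volume (-X)] at this
  convert this using 2
  ext W
  simp [← hf, sub_eq_add_neg]

/-- Cutting off the triangle `X Z Y` along the line `X Y`. -/
theorem cross_add_volume_inter_le {C : Set (Fin 2 → ℝ)} (hC : Convex ℝ C) (hK : IsCompact C)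
    {X Y Z : Fin 2 → ℝ} (hX : X ∈ C) (hY : Y ∈ C) (hZ : Z ∈ C) (h : 0 ≤ cross X Z Y) :
    cross X Z Y / 2 + volume.real (C ∩ {W | 0 ≤ cross X Y W}) ≤ volume.real C := by
  rcases h.eq_or_lt with h | h
  · rw [← h, zero_div, zero_add]
    exact measureReal_mono Set.inter_subset_left hK.measure_lt_top.ne
  set D := C ∩ {W | cross X Y W ≤ 0}
  have hDconv : Convex ℝ D := by
    refine hC.inter ?_
    have := convex_cross_nonneg Y X
    convert this using 3
    rw [show ∀ W, cross Y X W = - cross X Y W by intro W; unfold cross; ring, neg_nonneg]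
  have hDtop : volume D ≠ ⊤ :=
    ((measure_mono Set.inter_subset_left).trans_lt hK.measure_lt_top).ne
  have hD : |cross X Z Y| / 2 ≤ volume.real D :=
    hDconv.abs_cross_div_two_le_volume hDtop
      ⟨hX, by simp [cross]⟩ ⟨hZ, by simpa [cross_swap X Y Z] using h.le⟩
      ⟨hY, by simp [cross, mul_comm]⟩
  rw [abs_of_pos h] at hD
  have hzero : volume.real (D ∩ (C ∩ {W | 0 ≤ cross X Y W})) = 0 := by
    rw [Measure.real, measure_mono_null (t := {W | cross X Y W = 0}) _ _]
    · rfl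
    · rintro W ⟨⟨_, h1⟩, _, h2⟩
      exact le_antisymm h1 h2
    · refine volume_cross_eq_zero (Z := Z) ?_
      rw [cross_swap] at h
      intro h0
      rw [h0] at h
      simp at h
  have hunion := measureReal_union_add_inter (μ := volume) (s := D)
    (t := C ∩ {W | 0 ≤ cross X Y W})
    (hK.measurableSet.inter (isClosed_le continuous_const (continuous_cross X Y)).measurableSet)
    hDtop ((measure_mono Set.inter_subset_left).trans_lt hK.measure_lt_top).ne
  have hle : volume.real (D ∪ C ∩ {W | 0 ≤ cross X Y W}) ≤ volume.real C :=
    measureReal_mono (Set.union_subset Set.inter_subset_left Set.inter_subset_left)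
      hK.measure_lt_top.ne
  linarith

theorem quadrilateral_le_volume {K : Set (Fin 2 → ℝ)} (hconv : Convex ℝ K) (hK : IsCompact K)
    {P Q R S : Fin 2 → ℝ} (hP : P ∈ K) (hQ : Q ∈ K) (hR : R ∈ K) (hS : S ∈ K)
    (hPRQ : 0 ≤ cross P R Q) (hPQS : 0 ≤ cross P Q S) :
    (cross P R Q + cross P Q S) / 2 ≤ volume.real K := by
  have h1 := cross_add_volume_inter_le hconv hK hP hQ hR hPRQ
  have h2 := (hconv.inter (convex_cross_nonneg P Q)).abs_cross_div_two_le_volume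
    ((measure_mono Set.inter_subset_left).trans_lt hK.measure_lt_top).ne
    (X := P) (Y := Q) (Z := S)
    ⟨hP, by simp [cross]⟩ ⟨hQ, by simp [cross, mul_comm]⟩ ⟨hS, hPQS⟩
  rw [abs_of_nonneg hPQS] at h2
  linarith

theorem hexagon_le_volume {K : Set (Fin 2 → ℝ)} (hconv : Convex ℝ K) (hK : IsCompact K)
    {P R U Q S V : Fin 2 → ℝ} (hP : P ∈ K) (hR : R ∈ K) (hU : U ∈ K) (hQ : Q ∈ K) (hS : S ∈ K)
    (hV : V ∈ K) (hx : ∀ W ∈ K, P 0 ≤ W 0 ∧ W 0 ≤ Q 0) (hy : ∀ W ∈ K, R 1 ≤ W 1 ∧ W 1 ≤ S 1)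
    (hd : ∀ W ∈ K, V 0 - V 1 ≤ W 0 - W 1 ∧ W 0 - W 1 ≤ U 0 - U 1) :
    (cross R U Q + cross S V P + cross P R Q + cross P Q S) / 2 ≤ volume.real K := by
  have xR := hx R hR
  have xU := hx U hU
  have xS := hx S hS
  have xV := hx V hV
  have yP := hy P hP
  have yU := hy U hU
  have yQ := hy Q hQ
  have yV := hy V hV
  have dP := hd P hP
  have dR := hd R hR
  have dQ := hd Q hQ
  have dS := hd S hS
  have hRUQ : 0 ≤ cross R U Q := by
    unfold cross
    nlinarith [mul_nonneg (sub_nonneg.2 xU.2) (sub_nonneg.2 dR.2),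
      mul_nonneg (sub_nonneg.2 dQ.2) (sub_nonneg.2 yU.1),
      mul_nonneg (sub_nonneg.2 dQ.2) (sub_nonneg.2 dR.2)]
  have hSVP : 0 ≤ cross S V P := by
    unfold cross
    nlinarith [mul_nonneg (sub_nonneg.2 xV.1) (sub_nonneg.2 dS.1),
      mul_nonneg (sub_nonneg.2 dP.1) (sub_nonneg.2 yV.2),
      mul_nonneg (sub_nonneg.2 dP.1) (sub_nonneg.2 dS.1)]
  have hPRQ : 0 ≤ cross P R Q := by
    unfold cross
    nlinarith [mul_nonneg (sub_nonneg.2 xR.1) (sub_nonneg.2 yQ.1),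
      mul_nonneg (sub_nonneg.2 xR.2) (sub_nonneg.2 yP.1)]
  have hPQS : 0 ≤ cross P Q S := by
    unfold cross
    nlinarith [mul_nonneg (sub_nonneg.2 xS.1) (sub_nonneg.2 yQ.2),
      mul_nonneg (sub_nonneg.2 xS.2) (sub_nonneg.2 yP.2)]
  have hRQS : 0 ≤ cross R Q S := by
    unfold cross
    nlinarith [mul_nonneg (sub_nonneg.2 yQ.1) (sub_nonneg.2 xS.2),
      mul_nonneg (sub_nonneg.2 yQ.2) (sub_nonneg.2 xR.2)]
  have hSPR : 0 ≤ cross S P R := by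
    unfold cross
    nlinarith [mul_nonneg (sub_nonneg.2 yP.1) (sub_nonneg.2 xS.1),
      mul_nonneg (sub_nonneg.2 yP.2) (sub_nonneg.2 xR.1)]
  have hRQV : 0 ≤ cross R Q V := by
    unfold cross
    rcases le_total (Q 1 - R 1) (Q 0 - R 0) with h | h
    · rcases le_total (V 0) (R 0) with h' | h'
      · nlinarith [mul_nonneg (sub_nonneg.2 yQ.1) (sub_nonneg.2 h'),
          mul_nonneg (sub_nonneg.2 xR.2) (sub_nonneg.2 yV.1)]
      · nlinarith [mul_nonneg (sub_nonneg.2 xR.2) (sub_nonneg.2 dR.1),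
          mul_nonneg (sub_nonneg.2 h) (sub_nonneg.2 h')]
    · nlinarith [mul_nonneg (sub_nonneg.2 xR.2) (sub_nonneg.2 dQ.1),
          mul_nonneg (sub_nonneg.2 h) (sub_nonneg.2 xV.2)]
  set C := K ∩ {W | 0 ≤ cross R Q W}
  have hCconv : Convex ℝ C := hconv.inter (convex_cross_nonneg R Q)
  have hCcpt : IsCompact C :=
    hK.inter_right (isClosed_le continuous_const (continuous_cross R Q))
  have hPC : P ∈ C := ⟨hP, by simpa [cross_rotate P R Q] using hPRQ⟩
  have hRC : R ∈ C := ⟨hR, by simp [cross]⟩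
  have hQC : Q ∈ C := ⟨hQ, by simp [cross, mul_comm]⟩
  have hSC : S ∈ C := ⟨hS, hRQS⟩
  have h1 := cross_add_volume_inter_le hconv hK hR hQ hU hRUQ
  have h2 := cross_add_volume_inter_le hCconv hCcpt hSC hPC ⟨hV, hRQV⟩ hSVP
  have h3 := quadrilateral_le_volume (hCconv.inter (convex_cross_nonneg S P))
    (hCcpt.inter_right (isClosed_le continuous_const (continuous_cross S P)))
    (P := P) (Q := Q) (R := R) (S := S)
    ⟨hPC, by simp [cross, mul_comm]⟩ ⟨hQC, by simpa [cross_rotate S P Q] using hPQS⟩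
    ⟨hRC, hSPR⟩ ⟨hSC, by simp [cross]⟩ hPRQ hPQS
  linarith

theorem le_affine_of_le_endpoints {a b c t T : ℝ} (ht : 0 ≤ t) (htT : t ≤ T) (h0 : c ≤ a)
    (hT : c ≤ a + b * T) : c ≤ a + b * t := by
  rcases le_total 0 b with hb | hb
  · nlinarith [mul_nonneg hb ht]
  · nlinarith [mul_nonneg (neg_nonneg.2 hb) (sub_nonneg.2 htT)]

/-- The case of `hexagon_area_bound` in which the two extra vertices lie on the bottom side and on
the left side of the box. -/
theorem corner_area_bound {A B p q r s u v : ℝ} (hp : 0 ≤ p) (hq : q ≤ B) (hr : 0 ≤ r)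
    (hs : s ≤ A) (hpq : p ≤ q) (hrs : r ≤ s) (hur : r ≤ u) (hvp : p ≤ v) (hw : B ≤ u + v) :
    (q - p) * (s - r) ≤ (u - r) * q + s * (v - p) + A ^ 2 / 4 := by
  rcases le_total q v with h | h
  · nlinarith [mul_nonneg (hr.trans hrs) (sub_nonneg.2 h), mul_nonneg hr (sub_nonneg.2 hpq),
      mul_nonneg (sub_nonneg.2 hur) (hp.trans hpq), sq_nonneg A]
  rcases le_total s u with h' | h'
  · nlinarith [mul_nonneg (hp.trans hpq) (sub_nonneg.2 h'), mul_nonneg hp (sub_nonneg.2 hrs),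
      mul_nonneg (sub_nonneg.2 hvp) (hr.trans hrs), sq_nonneg A]
  have hsum : (q - v) + (s - u) ≤ A := by linarith
  have hsum0 : 0 ≤ (q - v) + (s - u) := by linarith
  nlinarith [mul_le_mul hvp hur hr (hp.trans hvp), sq_nonneg ((q - v) - (s - u)),
    mul_self_le_mul_self hsum0 hsum]

theorem hexagon_area_bound {A B p q r s u₁ u₂ v₁ v₂ : ℝ} (hAB : A ≤ B)
    (hp : 0 ≤ p) (hq : q ≤ B) (hr : 0 ≤ r) (hs : s ≤ A) (hpq : p ≤ q) (hrs : r ≤ s)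
    (hu₁ : u₁ ≤ A) (hu₂ : 0 ≤ u₂) (hv₁ : 0 ≤ v₁) (hv₂ : v₂ ≤ B)
    (hur : r ≤ u₁ - u₂) (huq : A - q ≤ u₁ - u₂) (hvp : v₁ - v₂ ≤ -p) (hvs : v₁ - v₂ ≤ s - B)
    (hw : B ≤ (u₁ - u₂) - (v₁ - v₂)) :
    A * B - A ^ 2 / 4 ≤ (u₁ - r) * q - u₂ * (A - r) + ((v₁ - s) * (p - B) - (v₂ - B) * (0 - s))
      + (A * B - (q - p) * (s - r)) := by
  obtain ⟨u, rfl⟩ : ∃ u, u₁ = u + u₂ := ⟨u₁ - u₂, by ring⟩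
  obtain ⟨v, rfl⟩ : ∃ v, v₂ = v₁ + v := ⟨v₂ - v₁, by ring⟩
  ring_nf at hur huq hvp hvs hw
  have key : ∀ x y : ℝ, (x = 0 ∨ x = A - u) → (y = 0 ∨ y = B - v) →
      A * B - A ^ 2 / 4 ≤ (u + x - r) * q - x * (A - r)
        + ((y - s) * (p - B) - (y + v - B) * (0 - s)) + (A * B - (q - p) * (s - r)) := by
    rintro x y (rfl | rfl) (rfl | rfl)
    · have := corner_area_bound hp hq hr hs hpq hrs (u := u) (v := v)
        (by linarith) (by linarith) (by linarith)
      linarith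
    · nlinarith [mul_nonneg (show 0 ≤ s - (B - v) by linarith) (sub_nonneg.2 hq),
        mul_nonneg (show 0 ≤ u - r by linarith) hp,
        mul_nonneg (sub_nonneg.2 hpq) (show 0 ≤ u - (B - v) by linarith), sq_nonneg A]
    · nlinarith [mul_nonneg (show 0 ≤ q - A + u by linarith) (sub_nonneg.2 hs),
        mul_nonneg (show 0 ≤ v - p by linarith) hr,
        mul_nonneg (sub_nonneg.2 hrs) (show 0 ≤ u + v - A by linarith), sq_nonneg A]
    · have := corner_area_bound (A := A) (B := B) (p := B - q) (q := B - p) (r := A - s)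
        (s := A - r) (u := A - B + v) (v := B - A + u) (by linarith) (by linarith) (by linarith)
        (by linarith) (by linarith) (by linarith) (by linarith) (by linarith) (by linarith)
      linarith
  have edge : ∀ x : ℝ, (x = 0 ∨ x = A - u) →
      A * B - A ^ 2 / 4 ≤ (u + x - r) * q - x * (A - r)
        + ((v₁ - s) * (p - B) - (v₁ + v - B) * (0 - s)) + (A * B - (q - p) * (s - r)) := by
    intro x hx
    have := le_affine_of_le_endpoints (c := A * B - A ^ 2 / 4)
      (a := (u + x - r) * q - x * (A - r)
        + ((0 - s) * (p - B) - (v - B) * (0 - s)) + (A * B - (q - p) * (s - r)))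
      (b := p - B + s) hv₁ (show v₁ ≤ B - v by linarith)
      ((key x 0 hx (Or.inl rfl)).trans_eq (by ring))
      ((key x _ hx (Or.inr rfl)).trans_eq (by ring))
    exact this.trans_eq (by ring)
  have := le_affine_of_le_endpoints (c := A * B - A ^ 2 / 4)
      (a := (u - r) * q
        + ((v₁ - s) * (p - B) - (v₁ + v - B) * (0 - s)) + (A * B - (q - p) * (s - r)))
      (b := q - A + r) hu₂ (show u₂ ≤ A - u by linarith)
      ((edge 0 (Or.inl rfl)).trans_eq (by ring))
      ((edge _ (Or.inr rfl)).trans_eq (by ring))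
  exact this.trans_eq (by ring)

theorem area_bound_of_increasing {K : Set (Fin 2 → ℝ)} (hconv : Convex ℝ K) (hK : IsCompact K)
    {P R U Q S V : Fin 2 → ℝ} (hP : P ∈ K) (hR : R ∈ K) (hU : U ∈ K) (hQ : Q ∈ K) (hS : S ∈ K)
    (hV : V ∈ K) (hx : ∀ W ∈ K, P 0 ≤ W 0 ∧ W 0 ≤ Q 0) (hy : ∀ W ∈ K, R 1 ≤ W 1 ∧ W 1 ≤ S 1)
    (hd : ∀ W ∈ K, V 0 - V 1 ≤ W 0 - W 1 ∧ W 0 - W 1 ≤ U 0 - U 1)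
    (hPQ : P 1 ≤ Q 1) (hRS : R 0 ≤ S 0) (hAB : Q 0 - P 0 ≤ S 1 - R 1)
    (hw : S 1 - R 1 ≤ (U 0 - U 1) - (V 0 - V 1)) :
    ((Q 0 - P 0) * (S 1 - R 1) - (Q 0 - P 0) ^ 2 / 4) / 2 ≤ volume.real K := by
  refine le_trans ?_ (hexagon_le_volume hconv hK hP hR hU hQ hS hV hx hy hd)
  have := hexagon_area_bound (A := Q 0 - P 0) (B := S 1 - R 1) (p := P 1 - R 1) (q := Q 1 - R 1)
    (r := R 0 - P 0) (s := S 0 - P 0) (u₁ := U 0 - P 0) (u₂ := U 1 - R 1) (v₁ := V 0 - P 0)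
    (v₂ := V 1 - R 1) hAB
    (by linarith [hy P hP]) (by linarith [hy Q hQ]) (by linarith [hx R hR])
    (by linarith [hx S hS]) (by linarith) (by linarith) (by linarith [hx U hU])
    (by linarith [hy U hU]) (by linarith [hx V hV]) (by linarith [hy V hV])
    (by linarith [hd R hR]) (by linarith [hd Q hQ]) (by linarith [hd P hP])
    (by linarith [hd S hS]) (by linarith)
  unfold cross
  linarith

theorem exists_extremal {K : Set (Fin 2 → ℝ)} (hK : IsCompact K) (hne : K.Nonempty)
    {f : (Fin 2 → ℝ) → ℝ} (hf : Continuous f) :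
    ∃ X ∈ K, ∃ Y ∈ K, ∀ W ∈ K, f X ≤ f W ∧ f W ≤ f Y := by
  obtain ⟨X, hX, hX'⟩ := hK.exists_isMinOn hne hf.continuousOn
  obtain ⟨Y, hY, hY'⟩ := hK.exists_isMaxOn hne hf.continuousOn
  exact ⟨X, hX, Y, hY, fun W hW => ⟨hX' hW, hY' hW⟩⟩

/-- Lower bound for the area of a planar convex set in terms of its widths in the directions
`(1, 0)` and `(0, 1)`, provided the widths in the directions `(1, 1)` and `(1, -1)` are not
smaller than the one in direction `(0, 1)`. -/
theorem area_bound_of_widths {K : Set (Fin 2 → ℝ)} (hconv : Convex ℝ K) (hK : IsCompact K)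
    {A B : ℝ} (hAB : A ≤ B)
    {P Q R S : Fin 2 → ℝ} (hP : P ∈ K) (hQ : Q ∈ K) (hR : R ∈ K) (hS : S ∈ K)
    (hx : ∀ W ∈ K, P 0 ≤ W 0 ∧ W 0 ≤ Q 0) (hy : ∀ W ∈ K, R 1 ≤ W 1 ∧ W 1 ≤ S 1)
    (hA : Q 0 - P 0 = A) (hB : S 1 - R 1 = B)
    (hsub : ∃ X ∈ K, ∃ Y ∈ K, B ≤ (Y 0 - Y 1) - (X 0 - X 1))
    (hadd : ∃ X ∈ K, ∃ Y ∈ K, B ≤ (Y 0 + Y 1) - (X 0 + X 1)) :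
    (A * B - A ^ 2 / 4) / 2 ≤ volume.real K := by
  subst hA hB
  have xR := hx R hR
  have xS := hx S hS
  have yP := hy P hP
  have yQ := hy Q hQ
  by_cases hle : (Q 1 - P 1) * (S 0 - R 0) ≤ 0
  · refine le_trans ?_ (quadrilateral_le_volume hconv hK hP hQ hR hS ?_ ?_)
    · unfold cross
      nlinarith [sq_nonneg (Q 0 - P 0)]
    · unfold cross
      nlinarith [mul_nonneg (sub_nonneg.2 xR.1) (sub_nonneg.2 yQ.1),
        mul_nonneg (sub_nonneg.2 xR.2) (sub_nonneg.2 yP.1)]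
    · unfold cross
      nlinarith [mul_nonneg (sub_nonneg.2 xS.1) (sub_nonneg.2 yQ.2),
        mul_nonneg (sub_nonneg.2 xS.2) (sub_nonneg.2 yP.2)]
  rcases pos_and_pos_or_neg_and_neg_of_mul_pos (not_le.1 hle) with ⟨h1, h2⟩ | ⟨h1, h2⟩
  · obtain ⟨V, hV, U, hU, hd⟩ := exists_extremal hK ⟨P, hP⟩
      (f := fun W => W 0 - W 1) (by fun_prop)
    obtain ⟨X, hX, Y, hY, hXY⟩ := hsub
    exact area_bound_of_increasing hconv hK hP hR hU hQ hS hV hx hy hd (by linarith)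
      (by linarith) hAB (by linarith [hd X hX, hd Y hY])
  · obtain ⟨V, hV, U, hU, hd⟩ := exists_extremal hK ⟨P, hP⟩
      (f := fun W => W 0 + W 1) (by fun_prop)
    obtain ⟨X, hX, Y, hY, hXY⟩ := hadd
    set M : Matrix (Fin 2) (Fin 2) ℝ := !![1, 0; 0, -1] with hM
    set f := Matrix.toLin' M with hf
    have f0 : ∀ W, f W 0 = W 0 := fun W => by simp [hf, hM, Matrix.mulVec, dotProduct]
    have f1 : ∀ W, f W 1 = - W 1 := fun W => by simp [hf, hM, Matrix.mulVec, dotProduct]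
    have hvol : volume.real (f '' K) = volume.real K := by
      rw [Measure.real, Measure.addHaar_image_linearMap, hf, LinearMap.det_toLin', hM,
        Matrix.det_fin_two_of]
      simp [Measure.real]
    have mem : ∀ W ∈ K, f W ∈ f '' K := fun W => Set.mem_image_of_mem f
    have := area_bound_of_increasing (hconv.linear_image f)
      (hK.image (LinearMap.continuous_of_finiteDimensional f)) (mem P hP) (mem S hS) (mem U hU)
      (mem Q hQ) (mem R hR) (mem V hV)
      (by rintro _ ⟨W, hW, rfl⟩; simpa only [f0] using hx W hW)
      (by rintro _ ⟨W, hW, rfl⟩; simpa only [f1, neg_le_neg_iff] using (hy W hW).symm)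
      (by rintro _ ⟨W, hW, rfl⟩; simpa only [f0, f1, sub_neg_eq_add] using hd W hW)
      (by simp only [f1]; linarith) (by simp only [f0]; linarith)
      (by simp only [f0, f1]; linarith)
      (by simp only [f0, f1]; linarith [hd X hX, hd Y hY])
    rw [hvol] at this
    simp only [f0, f1] at this
    linarith

/-- The width of `K` in direction `z`. -/
def dirWidth (K : Set (E 2)) (z : E 2) : ℝ := sSup ((fun x => ⟪x, z⟫) '' (K - K))

theorem isCompact_inner_image_sub {K : Set (E 2)} (hK : IsCompact K) (z : E 2) :
    IsCompact ((fun x => ⟪x, z⟫) '' (K - K)) :=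
  (sub_eq_add_neg K K ▸ hK.add hK.neg).image (by fun_prop)

theorem inner_sub_inner_le_dirWidth {K : Set (E 2)} (hK : IsCompact K) (z : E 2) {x y : E 2}
    (hx : x ∈ K) (hy : y ∈ K) : ⟪x, z⟫ - ⟪y, z⟫ ≤ dirWidth K z := by
  rw [← inner_sub_left]
  exact le_csSup (isCompact_inner_image_sub hK z).bddAbove
    (Set.mem_image_of_mem _ (Set.sub_mem_sub hx hy))

theorem exists_dirWidth_eq {K : Set (E 2)} (hK : IsCompact K) (hne : K.Nonempty) (z : E 2) :
    ∃ x ∈ K, ∃ y ∈ K, ⟪x, z⟫ - ⟪y, z⟫ = dirWidth K z := by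
  obtain ⟨w, ⟨x, hx, y, hy, rfl⟩, h⟩ :=
    (isCompact_inner_image_sub hK z).sSup_mem ((hne.sub hne).image _)
  exact ⟨x, hx, y, hy, by rw [← inner_sub_left]; exact h⟩

theorem exists_mul_abs_le_dirWidth {K : Set (E 2)} (hK : IsConvexBody K) :
    ∃ ε > 0, ∀ z i, ε * |z i| ≤ dirWidth K z := by
  obtain ⟨-, hcpt, c, hc⟩ := hK
  obtain ⟨δ, hδ, hball⟩ := Metric.isOpen_iff.1 isOpen_interior c hc
  refine ⟨δ, hδ, fun z i => ?_⟩
  have hmem : ∀ t : ℝ, |t| < δ → c + EuclideanSpace.single i t ∈ K := fun t ht =>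
    interior_subset (hball (by simpa [Metric.mem_ball, dist_eq_norm] using ht))
  have hhalf : |δ / 2| < δ := by rw [abs_of_pos (by positivity)]; linarith
  have h1 := hmem (δ / 2) hhalf
  have h2 := hmem (-(δ / 2)) (by rwa [abs_neg])
  have h3 := inner_sub_inner_le_dirWidth hcpt z h1 h2
  have h4 := inner_sub_inner_le_dirWidth hcpt z h2 h1
  simp only [inner_add_left, EuclideanSpace.inner_single_left] at h3 h4
  simp only [conj_trivial] at h3 h4
  rcases abs_cases (z i) with ⟨h, -⟩ | ⟨h, -⟩ <;> rw [h] <;> linarith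

theorem mem_smul_polarBody_csBody {K : Set (E 2)} (hK : IsCompact K) {z : E 2} {lam : ℝ}
    (hlam : 0 < lam) (h : dirWidth K z ≤ 2 * lam) : z ∈ lam • polarBody (csBody K) := by
  rw [Set.mem_smul_set_iff_inv_smul_mem₀ hlam.ne']
  rintro _ ⟨_, ⟨x, hx, y, hy, rfl⟩, rfl⟩
  have := inner_sub_inner_le_dirWidth hK z hx hy
  simp only [inner_smul_left, inner_smul_right, inner_sub_left, conj_trivial]
  rw [inv_mul_le_iff₀ hlam]
  linarith

theorem succMin_nonneg {n : ℕ} (L : Set (E n)) (i : ℕ) : 0 ≤ succMin L i :=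
  Real.sInf_nonneg fun _ h => h.1.le

theorem succMin_polarBody_csBody_le {K : Set (E 2)} (hK : IsCompact K) {i : ℕ} {lam : ℝ}
    (hlam : 0 < lam) {v : Fin i → E 2} (hv : LinearIndependent ℝ v)
    (hlat : ∀ j, isLatticePoint (v j)) (h : ∀ j, dirWidth K (v j) ≤ 2 * lam) :
    succMin (polarBody (csBody K)) i ≤ lam :=
  csInf_le ⟨0, fun _ h => h.1.le⟩
    ⟨hlam, v, hv, fun j => ⟨hlat j, mem_smul_polarBody_csBody hK hlam (h j)⟩⟩

/-- The lattice point with the given integer coordinates. -/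
def intVec (m : ℤ × ℤ) : E 2 := !₂[(m.1 : ℝ), (m.2 : ℝ)]

theorem intVec_zero_apply (m : ℤ × ℤ) : intVec m 0 = m.1 := rfl

theorem intVec_one_apply (m : ℤ × ℤ) : intVec m 1 = m.2 := rfl

theorem isLatticePoint_intVec (m : ℤ × ℤ) : isLatticePoint (intVec m) := by
  intro j
  fin_cases j
  exacts [⟨m.1, rfl⟩, ⟨m.2, rfl⟩]

theorem intVec_add (m k : ℤ × ℤ) : intVec (m + k) = intVec m + intVec k := by
  ext j; fin_cases j <;> simp [intVec]

theorem intVec_sub (m k : ℤ × ℤ) : intVec (m - k) = intVec m - intVec k := by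
  ext j; fin_cases j <;> simp [intVec]

theorem dirWidth_intVec_pos {K : Set (E 2)} (hK : IsConvexBody K) {m : ℤ × ℤ} (hm : m ≠ 0) :
    0 < dirWidth K (intVec m) := by
  obtain ⟨ε, hε, h⟩ := exists_mul_abs_le_dirWidth hK
  by_cases h1 : m.1 = 0
  · have h2 : m.2 ≠ 0 := fun h2 => hm (Prod.ext h1 h2)
    refine lt_of_lt_of_le ?_ (h _ 1)
    rw [intVec_one_apply]
    positivity
  · refine lt_of_lt_of_le ?_ (h _ 0)
    rw [intVec_zero_apply]
    positivity

theorem exists_forall_dirWidth_le {K : Set (E 2)} (hK : IsConvexBody K) {T : Set (ℤ × ℤ)}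
    (hT : T.Nonempty) :
    ∃ m ∈ T, ∀ k ∈ T, dirWidth K (intVec m) ≤ dirWidth K (intVec k) := by
  obtain ⟨ε, hε, h⟩ := exists_mul_abs_le_dirWidth hK
  obtain ⟨m₀, hm₀⟩ := hT
  set c := dirWidth K (intVec m₀) with hc
  have hbound : ∀ k : ℤ, ε * |(k : ℝ)| ≤ c → -⌈c / ε⌉ ≤ k ∧ k ≤ ⌈c / ε⌉ := by
    intro k hk
    have : |(k : ℝ)| ≤ c / ε := by rw [le_div_iff₀ hε]; linarith
    rw [← abs_le]
    exact_mod_cast this.trans (Int.le_ceil _)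
  have hfin : (T ∩ {m | dirWidth K (intVec m) ≤ c}).Finite := by
    refine (Set.finite_Icc ((-⌈c / ε⌉, -⌈c / ε⌉) : ℤ × ℤ) (⌈c / ε⌉, ⌈c / ε⌉)).subset ?_
    rintro m ⟨-, hm⟩
    have h0 := hbound m.1 ((h (intVec m) 0).trans hm)
    have h1 := hbound m.2 ((h (intVec m) 1).trans hm)
    exact ⟨⟨h0.1, h1.1⟩, h0.2, h1.2⟩
  obtain ⟨m, ⟨hmT, hmc⟩, hmin⟩ :=
    Set.exists_min_image _ (fun m => dirWidth K (intVec m)) hfin ⟨m₀, hm₀, hc.ge⟩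
  refine ⟨m, hmT, fun k hk => ?_⟩
  rcases le_total (dirWidth K (intVec k)) c with h' | h'
  · exact hmin k ⟨hk, h'⟩
  · exact le_trans hmc h'

/-- A lattice basis that is reduced with respect to the width function of `K`. -/
theorem exists_reduced_basis {K : Set (E 2)} (hK : IsConvexBody K) :
    ∃ m k : ℤ × ℤ, m ≠ 0 ∧ m.1 * k.2 - m.2 * k.1 = 1 ∧
      dirWidth K (intVec m) ≤ dirWidth K (intVec k) ∧
      dirWidth K (intVec k) ≤ dirWidth K (intVec (k + m)) ∧
      dirWidth K (intVec k) ≤ dirWidth K (intVec (k - m)) := by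
  obtain ⟨m, hm, hmin⟩ := exists_forall_dirWidth_le hK (T := {m | m ≠ 0}) ⟨(1, 0), by simp⟩
  have hpos := dirWidth_intVec_pos hK hm
  have hcop : Int.gcd m.1 m.2 = 1 := by
    have hg : 0 < Int.gcd m.1 m.2 := by
      rw [Int.gcd_pos_iff]
      by_contra! h
      exact hm (Prod.ext h.1 h.2)
    obtain ⟨a, ha⟩ := Int.gcd_dvd_left m.1 m.2
    obtain ⟨b, hb⟩ := Int.gcd_dvd_right m.1 m.2
    set g := Int.gcd m.1 m.2
    have hab : (a, b) ≠ (0 : ℤ × ℤ) := by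
      intro h
      obtain ⟨rfl, rfl⟩ := Prod.mk.inj h
      exact hm (Prod.ext (by simpa using ha) (by simpa using hb))
    obtain ⟨x, hx, y, hy, hxy⟩ := exists_dirWidth_eq hK.2.1 (hK.2.2.mono interior_subset)
      (intVec (a, b))
    have hvec : intVec m = (g : ℝ) • intVec (a, b) := by
      ext j
      fin_cases j
      · simpa [intVec] using congrArg (Int.cast : ℤ → ℝ) ha
      · simpa [intVec] using congrArg (Int.cast : ℤ → ℝ) hb
    have h1 := inner_sub_inner_le_dirWidth hK.2.1 (intVec m) hx hy
    have h2 : dirWidth K (intVec m) ≤ dirWidth K (intVec (a, b)) := hmin _ hab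
    have h3 : ⟪x, intVec m⟫ - ⟪y, intVec m⟫ = g * dirWidth K (intVec (a, b)) := by
      rw [hvec, inner_smul_right, inner_smul_right, ← mul_sub, hxy]
    by_contra hne
    have hg2 : (2 : ℝ) ≤ g := by exact_mod_cast (show 2 ≤ g by omega)
    nlinarith
  obtain ⟨k, hk, hkmin⟩ := exists_forall_dirWidth_le hK
    (T := {k | m.1 * k.2 - m.2 * k.1 = 1}) (by
      obtain ⟨a, b, hab⟩ := Int.isCoprime_iff_gcd_eq_one.2 hcop
      exact ⟨(-b, a), by simp only [Set.mem_ofPred_eq]; linear_combination hab⟩)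
  simp only [Set.mem_ofPred_eq] at hk hkmin
  refine ⟨m, k, hm, hk, hmin k ?_, hkmin _ ?_, hkmin _ ?_⟩
  · rintro rfl
    simp at hk
  · simp only [Prod.fst_add, Prod.snd_add]; linear_combination hk
  · simp only [Prod.fst_sub, Prod.snd_sub]; linear_combination hk

theorem linearIndependent_intVec_pair {m k : ℤ × ℤ} (h : m.1 * k.2 - m.2 * k.1 = 1) :
    LinearIndependent ℝ ![intVec m, intVec k] := by
  have hR : (m.1 * k.2 - m.2 * k.1 : ℝ) = 1 := by exact_mod_cast h
  rw [LinearIndependent.pair_iff]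
  intro s t hst
  have h0 := congrArg (fun z : E 2 => z 0) hst
  have h1 := congrArg (fun z : E 2 => z 1) hst
  simp [intVec] at h0 h1
  constructor
  · linear_combination (-s) * hR + k.2 * h0 - k.1 * h1
  · linear_combination (-t) * hR + m.1 * h1 - m.2 * h0

theorem area_bound_of_reduced_basis {K : Set (E 2)} (hK : IsConvexBody K) {m k : ℤ × ℤ}
    (hdet : m.1 * k.2 - m.2 * k.1 = 1)
    (hmk : dirWidth K (intVec m) ≤ dirWidth K (intVec k))
    (hadd : dirWidth K (intVec k) ≤ dirWidth K (intVec (k + m)))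
    (hsub : dirWidth K (intVec k) ≤ dirWidth K (intVec (k - m))) :
    (dirWidth K (intVec m) * dirWidth K (intVec k) - dirWidth K (intVec m) ^ 2 / 4) / 2 ≤
      (volume K).toReal := by
  obtain ⟨hconv, hcpt, hint⟩ := hK
  have hne : K.Nonempty := hint.mono interior_subset
  set M : Matrix (Fin 2) (Fin 2) ℝ := !![(m.1 : ℝ), m.2; k.1, k.2] with hM
  set f : E 2 →ₗ[ℝ] (Fin 2 → ℝ) :=
    Matrix.toLin' M ∘ₗ (WithLp.linearEquiv 2 ℝ (Fin 2 → ℝ)).toLinearMap with hf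
  have f0 : ∀ x, f x 0 = ⟪x, intVec m⟫ := fun x => by
    simp [hf, hM, intVec, Matrix.mulVec, dotProduct, PiLp.inner_apply, Fin.sum_univ_two]
  have f1 : ∀ x, f x 1 = ⟪x, intVec k⟫ := fun x => by
    simp [hf, hM, intVec, Matrix.mulVec, dotProduct, PiLp.inner_apply, Fin.sum_univ_two]
  have hvol : volume.real (f '' K) = (volume K).toReal := by
    have himg : f '' K = Matrix.toLin' M '' (WithLp.toLp 2 ⁻¹' K) := by
      rw [hf, LinearMap.coe_comp, Set.image_comp]
      congr 1
      exact (WithLp.linearEquiv 2 ℝ (Fin 2 → ℝ)).toEquiv.image_eq_preimage_symm K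
    have hMdet : M.det = 1 := by
      rw [hM, Matrix.det_fin_two_of]
      exact_mod_cast hdet
    rw [himg, Measure.real, Measure.addHaar_image_linearMap, LinearMap.det_toLin', hMdet,
      (PiLp.volume_preserving_toLp (Fin 2)).measure_preimage hcpt.measurableSet.nullMeasurableSet]
    simp
  rw [← hvol]
  have mem : ∀ x ∈ K, f x ∈ f '' K := fun x => Set.mem_image_of_mem f
  obtain ⟨Q, hQ, P, hP, hPQ⟩ := exists_dirWidth_eq hcpt hne (intVec m)
  obtain ⟨S, hS, R, hR, hRS⟩ := exists_dirWidth_eq hcpt hne (intVec k)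
  obtain ⟨x, hx, y, hy, hxy⟩ := exists_dirWidth_eq hcpt hne (intVec (k + m))
  obtain ⟨x', hx', y', hy', hxy'⟩ := exists_dirWidth_eq hcpt hne (intVec (k - m))
  rw [intVec_add, inner_add_right, inner_add_right, ← intVec_add] at hxy
  rw [intVec_sub, inner_sub_right, inner_sub_right, ← intVec_sub] at hxy'
  refine area_bound_of_widths (hconv.linear_image f)
    (hcpt.image (LinearMap.continuous_of_finiteDimensional f)) hmk (mem P hP) (mem Q hQ)
    (mem R hR) (mem S hS) ?_ ?_ (by rw [f0, f0, hPQ]) (by rw [f1, f1, hRS])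
    ⟨f x', mem x' hx', f y', mem y' hy', by simp only [f0, f1]; linarith⟩
    ⟨f y, mem y hy, f x, mem x hx, by simp only [f0, f1]; linarith⟩
  · rintro _ ⟨w, hw, rfl⟩
    have h1 := inner_sub_inner_le_dirWidth hcpt (intVec m) hw hP
    have h2 := inner_sub_inner_le_dirWidth hcpt (intVec m) hQ hw
    simp only [f0]
    constructor <;> linarith
  · rintro _ ⟨w, hw, rfl⟩
    have h1 := inner_sub_inner_le_dirWidth hcpt (intVec k) hw hR
    have h2 := inner_sub_inner_le_dirWidth hcpt (intVec k) hS hw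
    simp only [f1]
    constructor <;> linarith

theorem planar_lower_bound (K : Set (E 2)) (hK : IsConvexBody K) :
    (3/2) * succMin (polarBody (csBody K)) 1 * succMin (polarBody (csBody K)) 2
      + (1/2) * succMin (polarBody (csBody K)) 1 *
          (succMin (polarBody (csBody K)) 2 - succMin (polarBody (csBody K)) 1)
      ≤ (volume K).toReal := by
  obtain ⟨m, k, hm, hdet, hmk, hadd, hsub⟩ := exists_reduced_basis hK
  have harea := area_bound_of_reduced_basis hK hdet hmk hadd hsub
  have hpos := dirWidth_intVec_pos hK hm
  set a := dirWidth K (intVec m)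
  set b := dirWidth K (intVec k)
  have hind := linearIndependent_intVec_pair hdet
  have h1 : succMin (polarBody (csBody K)) 1 ≤ a / 2 := by
    refine succMin_polarBody_csBody_le hK.2.1 (half_pos hpos) (v := ![intVec m]) ?_ ?_ ?_
    · rw [linearIndependent_unique_iff]
      exact hind.ne_zero 0
    · simp [isLatticePoint_intVec]
    · simp only [Fin.forall_fin_one, Matrix.cons_val_fin_one]
      linarith
  have h2 : succMin (polarBody (csBody K)) 2 ≤ b / 2 := by
    refine succMin_polarBody_csBody_le hK.2.1 (half_pos (hpos.trans_le hmk)) hind ?_ ?_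
    · simp [Fin.forall_fin_two, isLatticePoint_intVec]
    · simp only [Fin.forall_fin_two, Matrix.cons_val_zero, Matrix.cons_val_one]
      constructor <;> linarith
  have h1' := succMin_nonneg (polarBody (csBody K)) 1
  set l₁ := succMin (polarBody (csBody K)) 1
  set l₂ := succMin (polarBody (csBody K)) 2
  nlinarith [mul_nonneg h1' (sub_nonneg.2 h2),
    mul_nonneg (sub_nonneg.2 h1) (show 0 ≤ 4 * (b / 2) - a / 2 - l₁ by linarith)]
end
end

section
/- Let K be a convex body in ℝⁿ. Then vol(K) ≤ 2ⁿ · ∏_{i=1}^{n} λᵢ((cs K)*), where λᵢ denote the successive minima with respect to the lattice ℤⁿ. -/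
open MeasureTheory
open scoped RealInnerProductSpace Pointwise

noncomputable section

/-- If for each `i < n` some `i + 1` linearly independent vectors satisfy `P i`, then for `k ≤ n`
there are `k` linearly independent vectors, the `j`-th of which satisfies `P j`. -/
theorem exists_linearIndependent_of_forall_lt {V : Type*} [AddCommGroup V] [Module ℝ V]
    (n : ℕ) (P : ℕ → V → Prop)
    (h : ∀ i < n, ∃ v : Fin (i + 1) → V, LinearIndependent ℝ v ∧ ∀ j, P i (v j)) :
    ∀ k ≤ n, ∃ w : Fin k → V, LinearIndependent ℝ w ∧ ∀ j : Fin k, P j (w j) := by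
  intro k
  induction k with
  | zero => exact fun _ => ⟨Fin.elim0, linearIndependent_empty_type, fun j => j.elim0⟩
  | succ k ih =>
    intro hk
    obtain ⟨w, hw, hPw⟩ := ih (by omega)
    obtain ⟨v, hv, hPv⟩ := h k (by omega)
    obtain ⟨j, hj⟩ : ∃ j, v j ∉ Submodule.span ℝ (Set.range w) := by
      by_contra! hcon
      have hle : Submodule.span ℝ (Set.range v) ≤ Submodule.span ℝ (Set.range w) :=
        Submodule.span_le.2 (Set.range_subset_iff.2 hcon)
      have hfin : Module.Finite ℝ (Submodule.span ℝ (Set.range w)) :=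
        Module.Finite.span_of_finite ℝ (Set.finite_range w)
      have hrank := Submodule.finrank_mono hle
      rw [finrank_span_eq_card hv, finrank_span_eq_card hw] at hrank
      simp at hrank
    refine ⟨Fin.snoc w (v j), linearIndependent_finSnoc.2 ⟨hw, hj⟩, fun i => ?_⟩
    refine Fin.lastCases ?_ (fun i => ?_) i
    · simpa using hPv j
    · simpa using hPw i

/-- The width of `K` in a direction lying in `lam • (cs K)*` is at most `2 * lam`. -/
theorem inner_sub_le_of_mem_smul_polarBody {n : ℕ} {K : Set (E n)} {lam : ℝ} (hlam : 0 < lam)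
    {v : E n} (hv : v ∈ lam • polarBody (csBody K)) {x y : E n} (hx : x ∈ K) (hy : y ∈ K) :
    ⟪v, x⟫ - ⟪v, y⟫ ≤ 2 * lam := by
  obtain ⟨u, hu, rfl⟩ := hv
  have h := hu ((2⁻¹ : ℝ) • (x - y)) (Set.smul_mem_smul_set (Set.sub_mem_sub hx hy))
  rw [real_inner_smul_left, real_inner_comm, inner_sub_right] at h
  simp only [real_inner_smul_left]
  nlinarith

/-- The determinant of linearly independent lattice points is at least `1` in absolute value. -/
theorem one_le_abs_det_of_isLatticePoint {n : ℕ} {w : Fin n → E n}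
    (hw : LinearIndependent ℝ w) (hlat : ∀ i, isLatticePoint (w i)) :
    1 ≤ |(Matrix.of fun i j => w i j).det| := by
  choose m hm using hlat
  have hli : LinearIndependent ℝ (Matrix.of fun i j => w i j).row :=
    hw.map' (WithLp.linearEquiv 2 ℝ (Fin n → ℝ)).toLinearMap (LinearEquiv.ker _)
  have hunit := (Matrix.linearIndependent_rows_iff_isUnit.1 hli)
  have hdet : (Matrix.of fun i j => w i j).det = (((Matrix.of m).det : ℤ) : ℝ) := by
    rw [Int.cast_det]
    congr 1
    ext i j
    exact hm i j
  have hne : (Matrix.of fun i j => w i j).det ≠ 0 :=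
    ((Matrix.isUnit_iff_isUnit_det _).1 hunit).ne_zero
  rw [hdet] at hne ⊢
  exact_mod_cast Int.one_le_abs (by exact_mod_cast hne)

/-- A compact set whose width in the direction of each of `n` linearly independent lattice points
`w i` is at most `c i` has volume at most `∏ i, c i`. -/
theorem volume_toReal_le_prod_of_width_le {n : ℕ} {K : Set (E n)} (hK : IsCompact K)
    (hne : K.Nonempty) {w : Fin n → E n} (hw : LinearIndependent ℝ w)
    (hlat : ∀ i, isLatticePoint (w i)) {c : Fin n → ℝ} (hc : ∀ i, 0 ≤ c i)
    (hwidth : ∀ i, ∀ x ∈ K, ∀ y ∈ K, ⟪w i, x⟫ - ⟪w i, y⟫ ≤ c i) :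
    (volume K).toReal ≤ ∏ i, c i := by
  have hmin : ∀ i, ∃ y ∈ K, ∀ x ∈ K, ⟪w i, y⟫ ≤ ⟪w i, x⟫ := fun i => by
    obtain ⟨y, hy, hmin⟩ := hK.exists_isMinOn hne
      (f := fun x => ⟪w i, x⟫) (by fun_prop)
    exact ⟨y, hy, fun x hx => hmin hx⟩
  choose y hyK hy using hmin
  set M : Matrix (Fin n) (Fin n) ℝ := Matrix.of fun i j => w i j with hM
  set K' : Set (Fin n → ℝ) := WithLp.toLp 2 ⁻¹' K
  have hvol : volume K' = volume K :=
    (PiLp.volume_preserving_toLp (Fin n)).measure_preimage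
      hK.measurableSet.nullMeasurableSet
  have hsub : Matrix.toLin' M '' K' ⊆
      Set.Icc (fun i => ⟪w i, y i⟫) (fun i => ⟪w i, y i⟫ + c i) := by
    rintro _ ⟨x, hx, rfl⟩
    have hcoord : ∀ i, Matrix.toLin' M x i = ⟪w i, WithLp.toLp 2 x⟫ := fun i => by
      simp [hM, Matrix.mulVec, dotProduct, PiLp.inner_apply, mul_comm]
    refine ⟨fun i => ?_, fun i => ?_⟩
    · rw [hcoord]
      exact hy i _ hx
    · rw [hcoord]
      linarith [hwidth i _ hx _ (hyK i)]
  have hle := measure_mono (μ := volume) hsub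
  rw [Measure.addHaar_image_linearMap, Real.volume_Icc_pi, LinearMap.det_toLin', hvol] at hle
  simp only [add_sub_cancel_left] at hle
  have hdet : 1 ≤ ENNReal.ofReal |M.det| := by
    simpa using one_le_abs_det_of_isLatticePoint hw hlat
  have hfinal : volume K ≤ ∏ i, ENNReal.ofReal (c i) :=
    (le_mul_of_one_le_left' hdet).trans hle
  rw [← ENNReal.ofReal_prod_of_nonneg fun i _ => hc i] at hfinal
  exact ENNReal.toReal_le_of_le_ofReal (Finset.prod_nonneg fun i _ => hc i) hfinal

/-- The dilates admitted in the definition of the `i`-th successive minimum of `(cs K)*` exist. -/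
theorem exists_dilate_polarBody_csBody {n : ℕ} {K : Set (E n)} (hK : IsCompact K)
    {i : ℕ} (hi : i ≤ n) :
    {lam : ℝ | 0 < lam ∧ ∃ v : Fin i → E n, LinearIndependent ℝ v ∧
      ∀ j, isLatticePoint (v j) ∧ v j ∈ lam • polarBody (csBody K)}.Nonempty := by
  obtain ⟨R, hRpos, hR⟩ := hK.isBounded.exists_pos_norm_le
  let b := EuclideanSpace.basisFun (Fin n) ℝ
  refine ⟨R, hRpos, fun j => b (Fin.castLE hi j),
    b.orthonormal.linearIndependent.comp _ (Fin.castLE_injective hi), fun j => ⟨fun k => ?_, ?_⟩⟩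
  · by_cases h : k = Fin.castLE hi j
    · exact ⟨1, by simp [b, h]⟩
    · exact ⟨0, by simp [b, h]⟩
  · rw [Set.mem_smul_set_iff_inv_smul_mem₀ hRpos.ne']
    rintro _ ⟨_, ⟨x, hx, y, hy, rfl⟩, rfl⟩
    simp only
    rw [real_inner_smul_left, real_inner_smul_right]
    have hinner : ⟪x - y, b (Fin.castLE hi j)⟫ ≤ 2 * R := by
      refine (real_inner_le_norm _ _).trans ?_
      rw [b.norm_eq_one, mul_one]
      linarith [norm_sub_le x y, hR x hx, hR y hy]
    calc (2⁻¹ : ℝ) * (R⁻¹ * ⟪x - y, b (Fin.castLE hi j)⟫)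
        ≤ 2⁻¹ * (R⁻¹ * (2 * R)) := by gcongr
      _ = 1 := by field_simp

theorem upper_bound_cs_polar (n : ℕ) (K : Set (E n)) (hK : IsConvexBody K) :
    (volume K).toReal
      ≤ 2 ^ n * ∏ i ∈ Finset.Icc 1 n, succMin (polarBody (csBody K)) i := by
  obtain ⟨-, hcomp, hint⟩ := hK
  have hne : K.Nonempty := hint.mono interior_subset
  have hseq : ∀ i : Fin n, ∃ u : ℕ → ℝ,
      Filter.Tendsto u Filter.atTop (nhds (succMin (polarBody (csBody K)) (i + 1))) ∧
      ∀ k, 0 < u k ∧ ∃ v : Fin (i + 1) → E n, LinearIndependent ℝ v ∧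
        ∀ j, isLatticePoint (v j) ∧ v j ∈ u k • polarBody (csBody K) := fun i => by
    obtain ⟨u, -, hu, hmem⟩ := exists_seq_tendsto_sInf
      (exists_dilate_polarBody_csBody hcomp (i := i + 1) i.isLt) ⟨0, fun _ h => h.1.le⟩
    exact ⟨u, hu, hmem⟩
  choose u hlim hu using hseq
  have hprod : ∏ i ∈ Finset.Icc 1 n, succMin (polarBody (csBody K)) i =
      ∏ i : Fin n, succMin (polarBody (csBody K)) (i + 1) := by
    rw [Fin.prod_univ_eq_prod_range (fun i => succMin (polarBody (csBody K)) (i + 1)) n,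
      Finset.range_eq_Ico, Finset.prod_Ico_add' (succMin (polarBody (csBody K))) 0 n 1]
    rfl
  rw [hprod]
  refine ge_of_tendsto' ((tendsto_finsetProd _ fun i _ => hlim i).const_mul (2 ^ n)) fun k => ?_
  obtain ⟨w, hw, hPw⟩ := exists_linearIndependent_of_forall_lt n
    (fun i v => ∀ hi : i < n,
      isLatticePoint v ∧ v ∈ u ⟨i, hi⟩ k • polarBody (csBody K))
    (fun i hi => by
      obtain ⟨v, hv, hmem⟩ := (hu ⟨i, hi⟩ k).2
      exact ⟨v, hv, fun j _ => hmem j⟩) n le_rfl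
  have hbound := volume_toReal_le_prod_of_width_le hcomp hne hw (fun i => (hPw i i.isLt).1)
    (c := fun i => 2 * u i k) (fun i => by linarith [(hu i k).1])
    (fun i x hx y hy => inner_sub_le_of_mem_smul_polarBody (hu i k).1 (hPw i i.isLt).2 hx hy)
  simpa [Finset.prod_mul_distrib] using hbound
end
end
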